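/- arXiv:2009.02709 — 6 statements merged into one kernel-verified Lean document; each statement's English description precedes it below -/
import Mathlib

section
/- Let P : ℝⁿ → ℝ ∪ {+∞} be a proper function and let z ∈ ℝⁿ be such that the interior of the subdifferential ∂P(z) is nonempty. Then for every z' ∈ ℝⁿ with z' ≠ z, the sets int(∂P(z)) and ∂P(z') are disjoint: int(∂P(z)) ∩ ∂P(z') = ∅. Equivalently, if int(∂P(z)) ∩ ∂P(z') ≠ ∅ then z = z'. -/
noncomputable section

/-- The subdifferential of an extended-real-valued function `h` at `x`:
`∂h(x) = {v : ∀ z, h z ≥ h x + ⟨v, z − x⟩}`. -/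
def subdiff {m : ℕ} (h : EuclideanSpace ℝ (Fin m) → EReal)
    (x : EuclideanSpace ℝ (Fin m)) : Set (EuclideanSpace ℝ (Fin m)) :=
  {v | ∀ z, h x + ((inner ℝ v (z - x) : ℝ) : EReal) ≤ h z}

/-- **Separation of subdifferentials.** If `P : ℝⁿ → ℝ ∪ {+∞}` is proper and
`int ∂P(z) ≠ ∅`, then for every `z' ≠ z` one has `int(∂P(z)) ∩ ∂P(z') = ∅`. -/
theorem separation_of_subdifferentials (n : ℕ)
    (P : EuclideanSpace ℝ (Fin n) → EReal)
    (hP_ne_bot : ∀ x, P x ≠ ⊥) (hP_proper : ∃ x, P x ≠ ⊤)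
    (z : EuclideanSpace ℝ (Fin n))
    (hz : (interior (subdiff P z)).Nonempty) :
    ∀ z' : EuclideanSpace ℝ (Fin n), z' ≠ z →
      interior (subdiff P z) ∩ subdiff P z' = ∅ := by
  intro z' hne
  rw [Set.eq_empty_iff_forall_notMem]
  rintro v ⟨hv, hv'⟩
  have fin : ∀ x, v ∈ subdiff P x → ∃ a : ℝ, P x = a := by
    intro x hx
    obtain ⟨y, hy⟩ := hP_proper
    have h := hx y
    have ht : P x ≠ ⊤ := by
      intro ht
      rw [ht, EReal.top_add_coe, top_le_iff] at h
      exact hy h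
    exact ⟨(P x).toReal, (EReal.coe_toReal ht (hP_ne_bot x)).symm⟩
  obtain ⟨a, ha⟩ := fin z (interior_subset hv)
  obtain ⟨b, hb⟩ := fin z' hv'
  have hc : Filter.Tendsto (fun t : ℝ => v + t • (z' - z)) (nhds 0) (nhds v) := by
    have : Continuous (fun t : ℝ => v + t • (z' - z)) := by fun_prop
    simpa using this.tendsto 0
  have hev := hc.eventually (mem_interior_iff_mem_nhds.mp hv)
  obtain ⟨ε, hε, hball⟩ := Metric.eventually_nhds_iff.mp hev
  have hw : v + (ε / 2) • (z' - z) ∈ subdiff P z := by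
    apply hball
    rw [Real.dist_eq, sub_zero, abs_of_pos (by linarith)]
    linarith
  have h1 := hw z'
  have h2 := hv' z
  rw [ha, hb, ← EReal.coe_add, EReal.coe_le_coe_iff] at h1 h2
  rw [inner_add_left, real_inner_smul_left, real_inner_self_eq_norm_sq] at h1
  rw [← neg_sub z' z, inner_neg_right] at h2
  have hpos : 0 < ‖z' - z‖ := norm_pos_iff.mpr (sub_ne_zero.mpr hne)
  have : 0 < ε / 2 * ‖z' - z‖ ^ 2 := by positivity
  linarith
end
end

section
/- Feature-wise screening rule: let g be a group, let β̂ ∈ ℝᵖ and θ̂ ∈ ℝⁿ satisfy the optimality link X_g^⊤ θ̂ ∈ ∂Ω_g(β̂_g), let β*_g ∈ ℝ^{|g|} be such that int ∂Ω_g(β*_g) ≠ ∅, and let ℛ ⊆ ℝⁿ be any set containing θ̂. If {X_g^⊤ θ : θ ∈ ℛ} ⊆ int ∂Ω_g(β*_g), then β̂_g = β*_g. -/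
noncomputable section

/-- Convexity for an extended-real-valued function. -/
def ERealConvexOn {m : ℕ} (h : EuclideanSpace ℝ (Fin m) → EReal) : Prop :=
  ∀ x y : EuclideanSpace ℝ (Fin m), ∀ a b : ℝ, 0 ≤ a → 0 ≤ b → a + b = 1 →
    h (a • x + b • y) ≤ (a : EReal) * h x + (b : EReal) * h y

/-- `X_g^⊤ θ`, the application of the transpose of the submatrix `X_g ∈ ℝ^{n×m}`
to a vector `θ ∈ ℝⁿ`. -/
def mvT {n m : ℕ} (Xg : Matrix (Fin n) (Fin m) ℝ) (θ : EuclideanSpace ℝ (Fin n)) :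
    EuclideanSpace ℝ (Fin m) :=
  WithLp.toLp 2 fun j => ∑ i, Xg i j * θ i

/-- **Feature-wise screening rule.** If `X_g^⊤ θ̂ ∈ ∂Ω_g(β̂_g)`,
`int ∂Ω_g(β*_g) ≠ ∅`, `θ̂ ∈ ℛ` and `X_g^⊤ ℛ ⊆ int ∂Ω_g(β*_g)`, then `β̂_g = β*_g`. -/
theorem feature_wise_screening_rule (n m : ℕ)
    (Xg : Matrix (Fin n) (Fin m) ℝ)
    (Ωg : EuclideanSpace ℝ (Fin m) → EReal)
    (hΩ_ne_bot : ∀ x, Ωg x ≠ ⊥) (hΩ_proper : ∃ x, Ωg x ≠ ⊤)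
    (hΩ_closed : LowerSemicontinuous Ωg) (hΩ_convex : ERealConvexOn Ωg)
    (βhat_g : EuclideanSpace ℝ (Fin m)) (θhat : EuclideanSpace ℝ (Fin n))
    (hopt : mvT Xg θhat ∈ subdiff Ωg βhat_g)
    (βstar_g : EuclideanSpace ℝ (Fin m))
    (hint : (interior (subdiff Ωg βstar_g)).Nonempty)
    (R : Set (EuclideanSpace ℝ (Fin n))) (hθR : θhat ∈ R)
    (hscreen : (fun θ => mvT Xg θ) '' R ⊆ interior (subdiff Ωg βstar_g)) :
    βhat_g = βstar_g := by
  have hv : mvT Xg θhat ∈ interior (subdiff Ωg βstar_g) := hscreen ⟨θhat, hθR, rfl⟩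
  generalize mvT Xg θhat = v at hopt hv
  have hfin : ∀ x w, w ∈ subdiff Ωg x → ∃ r : ℝ, Ωg x = (r : EReal) := by
    intro x w hw
    have htop : Ωg x ≠ ⊤ := by
      intro h
      obtain ⟨z, hz⟩ := hΩ_proper
      have h1 := hw z
      rw [h, EReal.top_add_coe] at h1
      exact hz (top_le_iff.mp h1)
    exact ⟨(Ωg x).toReal, (EReal.coe_toReal htop (hΩ_ne_bot x)).symm⟩
  obtain ⟨a, ha⟩ := hfin _ _ hopt
  obtain ⟨b, hb⟩ := hfin _ _ (interior_subset hv)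
  have hc : Continuous (fun t : ℝ => v + t • (βhat_g - βstar_g)) := by fun_prop
  have hn : (fun t : ℝ => v + t • (βhat_g - βstar_g)) ⁻¹' interior (subdiff Ωg βstar_g)
      ∈ nhds (0 : ℝ) :=
    (isOpen_interior.preimage hc).mem_nhds (by simpa using hv)
  obtain ⟨ε, hε, hball⟩ := Metric.mem_nhds_iff.mp hn
  have hmem : (ε / 2) ∈ Metric.ball (0 : ℝ) ε := by
    rw [Metric.mem_ball, Real.dist_eq, sub_zero, abs_of_pos (by linarith)]
    linarith
  have h1 := (interior_subset (hball hmem)) βhat_g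
  have h2 := hopt βstar_g
  rw [ha, hb] at h1 h2
  have h1' : b + inner ℝ (v + (ε / 2) • (βhat_g - βstar_g)) (βhat_g - βstar_g) ≤ a := by
    exact_mod_cast h1
  have h2' : a + inner ℝ v (βstar_g - βhat_g) ≤ b := by
    exact_mod_cast h2
  rw [inner_add_left, real_inner_smul_left, real_inner_self_eq_norm_sq] at h1'
  rw [← neg_sub, inner_neg_right] at h2'
  have h3 : ‖βhat_g - βstar_g‖ ^ 2 ≤ 0 := by
    by_contra hlt
    push Not at hlt
    have := mul_pos (half_pos hε) hlt
    linarith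
  have h4 : ‖βhat_g - βstar_g‖ = 0 := by
    have := sq_nonneg ‖βhat_g - βstar_g‖
    exact pow_eq_zero_iff (two_ne_zero) |>.mp (le_antisymm h3 this)
  exact sub_eq_zero.mp (norm_eq_zero.mp h4)
end
end

section
/- Sample-wise screening rule: suppose f(x) = Σ_{i=1}^n f_i(x_i) with each f_i : ℝ → ℝ ∪ {+∞} proper, closed and convex. Let β̂ ∈ ℝᵖ and θ̂ ∈ ℝⁿ satisfy, for a given index i ∈ {1,…,n}, the optimality link x_i^⊤ β̂ ∈ ∂f_i^*(−θ̂_i). Let θ*_i ∈ ℝ be such that int ∂f_i^*(θ*_i) ≠ ∅ and let ℛ ⊆ ℝᵖ be any set containing β̂. If {x_i^⊤ β : β ∈ ℛ} ⊆ int ∂f_i^*(θ*_i), then −θ̂_i = θ*_i. -/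
noncomputable section

/-- Subdifferential of an extended-real-valued function of a real variable. -/
def subdiffR (h : ℝ → EReal) (x : ℝ) : Set ℝ :=
  {v | ∀ z, h x + ((v * (z - x) : ℝ) : EReal) ≤ h z}

/-- Fenchel conjugate of an extended-real-valued function of a real variable:
`h*(v) = sup_x v·x − h(x)`. -/
def fconjR (h : ℝ → EReal) (v : ℝ) : EReal :=
  ⨆ x : ℝ, ((v * x : ℝ) : EReal) - h x

/-- Convexity of an extended-real-valued function of a real variable. -/
def ERealConvexOnR (h : ℝ → EReal) : Prop :=
  ∀ x y : ℝ, ∀ a b : ℝ, 0 ≤ a → 0 ≤ b → a + b = 1 →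
    h (a * x + b * y) ≤ (a : EReal) * h x + (b : EReal) * h y

theorem aux_slope (h : ℝ → EReal) (hc : ERealConvexOnR h) {x m y rx rm ry : ℝ}
    (hx : h x = rx) (hm : h m = rm) (hy : h y = ry) (h1 : x < m) (h2 : m < y) :
    (rm - rx) / (m - x) ≤ (ry - rm) / (y - m) := by
  have hp : 0 < y - x := by linarith
  have := hc x y ((y - m) / (y - x)) ((m - x) / (y - x))
    (div_nonneg (by linarith) hp.le) (div_nonneg (by linarith) hp.le)
    (by field_simp; ring)
  have e : (y - m) / (y - x) * x + (m - x) / (y - x) * y = m := by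
    field_simp; ring
  rw [e, hx, hy, hm, ← EReal.coe_mul, ← EReal.coe_mul, ← EReal.coe_add,
    EReal.coe_le_coe_iff] at this
  have e2 : (y - m) / (y - x) * rx + (m - x) / (y - x) * ry
      = ((y - m) * rx + (m - x) * ry) / (y - x) := by ring
  rw [e2, le_div_iff₀ hp] at this
  rw [div_le_div_iff₀ (by linarith) (by linarith)]
  nlinarith

theorem aux_real (h : ℝ → EReal) (hb : ∀ x, h x ≠ ⊥) {x : ℝ} (ht : h x ≠ ⊤) :
    ∃ r : ℝ, h x = r := ⟨(h x).toReal, (EReal.coe_toReal ht (hb x)).symm⟩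

theorem aux_minorant_of_lt (h : ℝ → EReal) (hc : ERealConvexOnR h) (hb : ∀ x, h x ≠ ⊥)
    {x0 x1 : ℝ} (h0 : h x0 ≠ ⊤) (h1 : h x1 ≠ ⊤) (hlt : x0 < x1) :
    ∃ k c : ℝ, ∀ x, ((k * x + c : ℝ) : EReal) ≤ h x := by
  obtain ⟨r0, h0⟩ := aux_real h hb h0
  obtain ⟨r1, h1⟩ := aux_real h hb h1
  obtain ⟨m, hm⟩ : ∃ m : ℝ, m = 1 / 2 * x0 + 1 / 2 * x1 := ⟨_, rfl⟩
  have hmt : h m ≠ ⊤ := by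
    have := hc x0 x1 (1 / 2) (1 / 2) (by norm_num) (by norm_num) (by norm_num)
    rw [← hm, h0, h1, ← EReal.coe_mul, ← EReal.coe_mul, ← EReal.coe_add] at this
    exact ne_top_of_le_ne_top (EReal.coe_ne_top _) this
  obtain ⟨rm, hrm⟩ := aux_real h hb hmt
  obtain ⟨k, hk1, hk2⟩ := exists_between_of_forall_le
    (s := {s : ℝ | ∃ x r : ℝ, x < m ∧ h x = r ∧ s = (rm - r) / (m - x)})
    (t := {s : ℝ | ∃ y r : ℝ, m < y ∧ h y = r ∧ s = (r - rm) / (y - m)})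
    ⟨_, x0, r0, by linarith, h0, rfl⟩ ⟨_, x1, r1, by linarith, h1, rfl⟩ (by
      rintro _ ⟨x, rx, hx, hrx, rfl⟩ _ ⟨y, ry, hy, hry, rfl⟩
      exact aux_slope h hc hrx hrm hry hx hy)
  refine ⟨k, rm - k * m, fun x => ?_⟩
  by_cases hx : h x = ⊤
  · rw [hx]; exact le_top
  obtain ⟨r, hr⟩ := aux_real h hb hx
  rw [hr, EReal.coe_le_coe_iff]
  rcases lt_trichotomy x m with hxm | hxm | hxm
  · have := hk1 ⟨x, r, hxm, hr, rfl⟩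
    rw [div_le_iff₀ (by linarith)] at this
    linarith
  · subst hxm
    rw [hr, EReal.coe_eq_coe_iff] at hrm
    linarith
  · have := hk2 ⟨x, r, hxm, hr, rfl⟩
    rw [le_div_iff₀ (by linarith)] at this
    linarith

theorem aux_minorant (h : ℝ → EReal) (hc : ERealConvexOnR h) (hb : ∀ x, h x ≠ ⊥)
    (hp : ∃ x, h x ≠ ⊤) :
    ∃ k c : ℝ, ∀ x, ((k * x + c : ℝ) : EReal) ≤ h x := by
  obtain ⟨x0, h0⟩ := hp
  by_cases H : ∃ x1, x1 ≠ x0 ∧ h x1 ≠ ⊤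
  · obtain ⟨x1, hne, h1⟩ := H
    rcases lt_or_gt_of_ne hne with hl | hl
    · exact aux_minorant_of_lt h hc hb h1 h0 hl
    · exact aux_minorant_of_lt h hc hb h0 h1 hl
  · push Not at H
    obtain ⟨r0, hr0⟩ := aux_real h hb h0
    refine ⟨0, r0, fun x => ?_⟩
    by_cases hx : x = x0
    · subst hx; rw [hr0]; simp
    · rw [H x hx]; exact le_top

theorem aux_conj_top (h : ℝ → EReal) (hc : ERealConvexOnR h) (hb : ∀ x, h x ≠ ⊥)
    (hp : ∃ x, h x ≠ ⊤) : ∃ k, fconjR h k ≠ ⊤ := by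
  obtain ⟨k, c, H⟩ := aux_minorant h hc hb hp
  refine ⟨k, ne_top_of_le_ne_top (EReal.coe_ne_top (-c)) (iSup_le fun x => ?_)⟩
  by_cases hx : h x = ⊤
  · rw [hx]; simp
  obtain ⟨r, hr⟩ := aux_real h hb hx
  have := H x
  rw [hr, EReal.coe_le_coe_iff] at this
  rw [hr, ← EReal.coe_sub, EReal.coe_le_coe_iff]
  linarith

theorem aux_conj_bot (h : ℝ → EReal) (hb : ∀ x, h x ≠ ⊥)
    (hp : ∃ x, h x ≠ ⊤) (v : ℝ) : fconjR h v ≠ ⊥ := by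
  obtain ⟨x, hx⟩ := hp
  obtain ⟨r, hr⟩ := aux_real h hb hx
  refine ne_bot_of_le_ne_bot (EReal.coe_ne_bot (v * x - r)) ?_
  refine le_trans ?_ (le_iSup (fun x : ℝ => ((v * x : ℝ) : EReal) - h x) x)
  simp only [hr, EReal.coe_sub, le_refl]

theorem aux_sub_finite (g : ℝ → EReal) (hg : ∃ k, g k ≠ ⊤) {a v : ℝ}
    (hv : v ∈ subdiffR g a) : g a ≠ ⊤ := by
  obtain ⟨k, hk⟩ := hg
  intro ha
  have := hv k
  rw [ha, EReal.top_add_coe] at this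
  exact hk (top_le_iff.mp this)

theorem aux_main (g : ℝ → EReal) (hg : ∃ k, g k ≠ ⊤) (hb : ∀ x, g x ≠ ⊥) {a s v : ℝ}
    (hv : v ∈ subdiffR g a) (hs : v ∈ interior (subdiffR g s)) : a = s := by
  obtain ⟨ra, hra⟩ := aux_real g hb (aux_sub_finite g hg hv)
  obtain ⟨rs, hrs⟩ := aux_real g hb (aux_sub_finite g hg (interior_subset hs))
  obtain ⟨ε, hε, hball⟩ := Metric.isOpen_iff.mp isOpen_interior v hs
  have key : ∀ w ∈ Metric.ball v ε, (w - v) * (a - s) ≤ 0 := by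
    intro w hw
    have h1 := interior_subset (hball hw) a
    have h2 := hv s
    rw [hra, hrs, ← EReal.coe_add, EReal.coe_le_coe_iff] at h1 h2
    linarith
  have k1 := key (v + ε / 2) (by
    rw [Metric.mem_ball, Real.dist_eq, add_sub_cancel_left, abs_of_pos (by linarith)]; linarith)
  have k2 := key (v - ε / 2) (by
    rw [Metric.mem_ball, Real.dist_eq, sub_sub_cancel_left, abs_neg,
      abs_of_pos (by linarith)]; linarith)
  have h0 : ε / 2 * (a - s) = 0 := by linarith
  have := (mul_eq_zero.mp h0).resolve_left (by linarith)
  linarith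

/-- **Sample-wise screening rule.** Suppose `f(x) = Σᵢ fᵢ(xᵢ)` with each `fᵢ`
proper, closed, convex. If `xᵢ^⊤ β̂ ∈ ∂fᵢ*(−θ̂ᵢ)`, `int ∂fᵢ*(θ*ᵢ) ≠ ∅`, `β̂ ∈ ℛ`
and `{xᵢ^⊤ β : β ∈ ℛ} ⊆ int ∂fᵢ*(θ*ᵢ)`, then `−θ̂ᵢ = θ*ᵢ`. -/
theorem sample_wise_screening_rule (n p : ℕ)
    (X : Matrix (Fin n) (Fin p) ℝ)
    (f : EuclideanSpace ℝ (Fin n) → EReal)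
    (fi : Fin n → ℝ → EReal)
    (hf_sep : ∀ x : EuclideanSpace ℝ (Fin n), f x = ∑ i, fi i (x i))
    (hfi_ne_bot : ∀ i x, fi i x ≠ ⊥) (hfi_proper : ∀ i, ∃ x, fi i x ≠ ⊤)
    (hfi_closed : ∀ i, LowerSemicontinuous (fi i))
    (hfi_convex : ∀ i, ERealConvexOnR (fi i))
    (i : Fin n)
    (βhat : EuclideanSpace ℝ (Fin p)) (θhat : EuclideanSpace ℝ (Fin n))
    (hopt : (∑ j, X i j * βhat j) ∈ subdiffR (fconjR (fi i)) (-θhat i))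
    (θstar_i : ℝ)
    (hint : (interior (subdiffR (fconjR (fi i)) θstar_i)).Nonempty)
    (R : Set (EuclideanSpace ℝ (Fin p))) (hβR : βhat ∈ R)
    (hscreen : (fun β : EuclideanSpace ℝ (Fin p) => ∑ j, X i j * β j) '' R
        ⊆ interior (subdiffR (fconjR (fi i)) θstar_i)) :
    -θhat i = θstar_i := by
  exact aux_main (fconjR (fi i))
    (aux_conj_top (fi i) (hfi_convex i) (hfi_ne_bot i) (hfi_proper i))
    (aux_conj_bot (fi i) (hfi_ne_bot i) (hfi_proper i)) hopt
    (hscreen ⟨βhat, hβR, rfl⟩)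
end
end

section
/- General safe screening rule: let g be a group, β̂ ∈ ℝᵖ and θ̂ ∈ ℝⁿ with X_g^⊤ θ̂ ∈ ∂Ω_g(β̂_g), and let β*_g ∈ ℝ^{|g|} be such that int ∂Ω_g(β*_g) ≠ ∅. Let ℛ ⊆ ℝⁿ be a nonempty compact convex set containing θ̂. If for every direction d ∈ ℝ^{|g|} with ‖d‖ = 1 one has σ_{X_g^⊤ ℛ}(d) < σ_{∂Ω_g(β*_g)}(d), then β̂_g = β*_g. (Here X_g^⊤ ℛ = {X_g^⊤ θ : θ ∈ ℛ}.) -/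
noncomputable section

/-- Support function of a set: `σ_C(d) = sup_{c ∈ C} ⟨c, d⟩`. -/
def sfun {m : ℕ} (C : Set (EuclideanSpace ℝ (Fin m))) (d : EuclideanSpace ℝ (Fin m)) : EReal :=
  ⨆ c ∈ C, ((inner ℝ c d : ℝ) : EReal)

/-- **General safe screening rule.** If `θ̂ ∈ ℛ` (nonempty compact convex) and
`σ_{X_g^⊤ℛ}(d) < σ_{∂Ω_g(β*_g)}(d)` for every unit direction `d`, then `β̂_g = β*_g`. -/
theorem general_safe_screening_rule (n m : ℕ)
    (Xg : Matrix (Fin n) (Fin m) ℝ)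
    (Ωg : EuclideanSpace ℝ (Fin m) → EReal)
    (hΩ_ne_bot : ∀ x, Ωg x ≠ ⊥) (hΩ_proper : ∃ x, Ωg x ≠ ⊤)
    (hΩ_closed : LowerSemicontinuous Ωg) (hΩ_convex : ERealConvexOn Ωg)
    (βhat_g : EuclideanSpace ℝ (Fin m)) (θhat : EuclideanSpace ℝ (Fin n))
    (hopt : mvT Xg θhat ∈ subdiff Ωg βhat_g)
    (βstar_g : EuclideanSpace ℝ (Fin m))
    (hint : (interior (subdiff Ωg βstar_g)).Nonempty)
    (R : Set (EuclideanSpace ℝ (Fin n)))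
    (hR_ne : R.Nonempty) (hR_cpt : IsCompact R) (hR_cvx : Convex ℝ R)
    (hθR : θhat ∈ R)
    (htest : ∀ d : EuclideanSpace ℝ (Fin m), ‖d‖ = 1 →
      sfun ((fun θ => mvT Xg θ) '' R) d < sfun (subdiff Ωg βstar_g) d) :
    βhat_g = βstar_g := by
  have fin : ∀ x v, v ∈ subdiff Ωg x → Ωg x ≠ ⊤ := by
    intro x v hv hx
    obtain ⟨x0, h0⟩ := hΩ_proper
    have h := hv x0
    rw [hx, EReal.top_add_coe] at h
    exact h0 (top_le_iff.mp h)
  by_contra hne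
  have hd : βhat_g - βstar_g ≠ 0 := sub_ne_zero.mpr hne
  have hpos : 0 < ‖βhat_g - βstar_g‖ := norm_pos_iff.mpr hd
  have hlt := htest (‖βhat_g - βstar_g‖⁻¹ • (βhat_g - βstar_g)) (by
    rw [norm_smul, norm_inv, norm_norm, inv_mul_cancel₀ hpos.ne'])
  refine absurd hlt (not_lt.mpr ?_)
  unfold sfun
  refine iSup₂_le fun c hc => ?_
  refine le_trans ?_ (le_iSup₂ (f := fun c (_ : c ∈ (fun θ => mvT Xg θ) '' R) =>
    ((inner ℝ c (‖βhat_g - βstar_g‖⁻¹ • (βhat_g - βstar_g)) : ℝ) : EReal))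
    (mvT Xg θhat) ⟨θhat, hθR, rfl⟩)
  have h1 := hc βhat_g
  have h2 := hopt βstar_g
  have f1 := fin _ _ hc
  have f2 := fin _ _ hopt
  generalize mvT Xg θhat = v at *
  rw [← EReal.coe_toReal f1 (hΩ_ne_bot _), ← EReal.coe_toReal f2 (hΩ_ne_bot _)] at h1 h2
  norm_cast at h1 h2
  rw [EReal.coe_le_coe_iff, inner_smul_right, inner_smul_right]
  refine mul_le_mul_of_nonneg_left ?_ (inv_nonneg.mpr hpos.le)
  rw [← neg_sub βhat_g βstar_g, inner_neg_right] at h2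
  linarith
end
end

section
/- Gap safe sphere: let D : ℝⁿ → ℝ ∪ {−∞} be μ_D-strongly concave with μ_D > 0, let θ̂ be a maximizer of D, and let p ∈ ℝ satisfy p ≥ D(θ̂) (weak duality). Then for every θ ∈ ℝⁿ with D(θ) > −∞, ‖θ̂ − θ‖² ≤ (2/μ_D) (p − D(θ)). In particular, taking p = P(β) for a primal-feasible β, the dual optimum θ̂ belongs to the closed ball B(θ, √((2/μ_D) Gap(β, θ))), where Gap(β, θ) = P(β) − D(θ). -/
noncomputable section

/-- **Gap safe sphere.** If `D : ℝⁿ → ℝ ∪ {−∞}` is `μ_D`-strongly concave with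
`μ_D > 0`, `θ̂` maximizes `D`, and `p ≥ D(θ̂)` (weak duality), then for every `θ`
with `D(θ) > −∞`: `‖θ̂ − θ‖² ≤ (2/μ_D)(p − D(θ))`; in particular `θ̂` belongs to
the closed ball of center `θ` and radius `√((2/μ_D)(p − D(θ)))`. -/
theorem gap_safe_sphere (n : ℕ) (D : EuclideanSpace ℝ (Fin n) → EReal)
    (hD_ne_top : ∀ θ, D θ ≠ ⊤)
    (μD : ℝ) (hμ : 0 < μD)
    (hconc : ∀ θ₁ θ₂ : EuclideanSpace ℝ (Fin n), ∀ t : ℝ, 0 ≤ t → t ≤ 1 →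
      ((t : ℝ) : EReal) * D θ₁ + (((1 - t) : ℝ) : EReal) * D θ₂
          + ((μD / 2 * t * (1 - t) * ‖θ₁ - θ₂‖ ^ 2 : ℝ) : EReal)
        ≤ D (t • θ₁ + (1 - t) • θ₂))
    (θhat : EuclideanSpace ℝ (Fin n)) (hmax : ∀ θ, D θ ≤ D θhat)
    (p : ℝ) (hp : D θhat ≤ (p : EReal)) :
    ∀ θ : EuclideanSpace ℝ (Fin n), D θ ≠ ⊥ →
      ((‖θhat - θ‖ ^ 2 : ℝ) : EReal) ≤ ((2 / μD : ℝ) : EReal) * ((p : EReal) - D θ) ∧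
      θhat ∈ Metric.closedBall θ (Real.sqrt ((2 / μD) * ((p : EReal) - D θ).toReal)) := by
  intro θ hθ
  have hb : D θhat ≠ ⊥ := fun h => hθ (le_bot_iff.mp (h ▸ hmax θ))
  obtain ⟨a, ha⟩ : ∃ a : ℝ, D θ = (a : EReal) :=
    ⟨_, (EReal.coe_toReal (hD_ne_top θ) hθ).symm⟩
  obtain ⟨b, hbb⟩ : ∃ b : ℝ, D θhat = (b : EReal) :=
    ⟨_, (EReal.coe_toReal (hD_ne_top θhat) hb).symm⟩
  have hab : a ≤ b := by
    have h := hmax θ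
    rw [ha, hbb] at h
    exact_mod_cast h
  have hbp : b ≤ p := by
    rw [hbb] at hp
    exact_mod_cast hp
  have key : ∀ t : ℝ, 0 ≤ t → t ≤ 1 →
      t * b + (1 - t) * a + μD / 2 * t * (1 - t) * ‖θhat - θ‖ ^ 2 ≤ b := by
    intro t h0 h1
    have h := (hconc θhat θ t h0 h1).trans (hmax _)
    rw [ha, hbb, ← EReal.coe_mul, ← EReal.coe_mul, ← EReal.coe_add, ← EReal.coe_add] at h
    exact EReal.coe_le_coe_iff.mp h
  have hK : μD / 2 * ‖θhat - θ‖ ^ 2 ≤ b - a := by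
    by_contra! hlt
    set K := μD / 2 * ‖θhat - θ‖ ^ 2 with hKdef
    have hKpos : 0 < K := by linarith
    set t := (K + (b - a)) / (2 * K) with ht
    have htK : t * K = (K + (b - a)) / 2 := by
      rw [ht]; field_simp
    have ht0 : 0 ≤ t := by
      apply div_nonneg <;> linarith
    have ht1 : t < 1 := by
      rw [ht, div_lt_one (by linarith)]; linarith
    have h := key t ht0 ht1.le
    have h2 : (1 - t) * (t * K - (b - a)) ≤ 0 := by
      rw [hKdef]; linarith
    have h3 : 0 < (1 - t) * (t * K - (b - a)) :=
      mul_pos (by linarith) (by linarith)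
    linarith
  have hmain : ‖θhat - θ‖ ^ 2 ≤ (2 / μD) * (p - a) := by
    rw [div_mul_eq_mul_div, le_div_iff₀ hμ]
    linarith
  rw [ha, ← EReal.coe_sub, ← EReal.coe_mul, EReal.toReal_coe]
  refine ⟨EReal.coe_le_coe_iff.mpr hmain, ?_⟩
  rw [Metric.mem_closedBall, dist_eq_norm]
  exact Real.le_sqrt_of_sq_le hmain
end
end

section
/- Complexity of active-set identification under sublinear convergence (bounded-support case): let μ_D > 0, δ > 0, γ > 0, C > 0 and A > 0 (in the screening application A = ν_f σ_X² L², with σ_X the spectral norm of X and L the radius of dom Ω). Let (E_k)_{k≥1}, (G_k)_{k≥1} be sequences of nonnegative reals with E_k ≤ C / k^γ and G_k ≤ √(8 A E_k) for all k ≥ 1, and set r_k := √(2 G_k / μ_D). Then for every k ≥ 1 with k^γ > 32 A C / (μ_D δ²)², one has r_k < δ; hence the first index k₀ with r_{k₀} < δ satisfies k₀ ≤ ( 32 A C / (μ_D δ²)² )^{1/γ} + 1. -/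
noncomputable section

/-- **Complexity of active-set identification under sublinear convergence
(bounded-support case).** If `E_k ≤ C/k^γ`, `G_k ≤ √(8AE_k)` and
`r_k = √(2G_k/μ_D)`, then `r_k < δ` for every `k ≥ 1` with
`k^γ > 32AC/(μ_Dδ²)²`; hence the first index `k₀` with `r_{k₀} < δ` satisfies
`k₀ ≤ (32AC/(μ_Dδ²)²)^{1/γ} + 1`. -/
theorem active_set_identification_sublinear_rate
    (μD δ γ C A : ℝ) (hμ : 0 < μD) (hδ : 0 < δ) (hγ : 0 < γ) (hC : 0 < C) (hA : 0 < A)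
    (E G : ℕ → ℝ) (hE_nonneg : ∀ k, 1 ≤ k → 0 ≤ E k) (hG_nonneg : ∀ k, 1 ≤ k → 0 ≤ G k)
    (hE : ∀ k : ℕ, 1 ≤ k → E k ≤ C / (k : ℝ) ^ γ)
    (hG : ∀ k : ℕ, 1 ≤ k → G k ≤ Real.sqrt (8 * A * E k)) :
    (∀ k : ℕ, 1 ≤ k → 32 * A * C / (μD * δ ^ 2) ^ 2 < (k : ℝ) ^ γ →
      Real.sqrt (2 * G k / μD) < δ) ∧
    (((sInf {k : ℕ | 1 ≤ k ∧ Real.sqrt (2 * G k / μD) < δ} : ℕ) : ℝ)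
      ≤ (32 * A * C / (μD * δ ^ 2) ^ 2) ^ (1 / γ) + 1) := by
  have h1 : ∀ k : ℕ, 1 ≤ k → 32 * A * C / (μD * δ ^ 2) ^ 2 < (k : ℝ) ^ γ →
      Real.sqrt (2 * G k / μD) < δ := by
    intro k hk hlt
    have hk0 : (0 : ℝ) < k := by exact_mod_cast hk
    have hp : (0 : ℝ) < (k : ℝ) ^ γ := Real.rpow_pos_of_pos hk0 γ
    have hm : 0 < μD * δ ^ 2 := by positivity
    rw [div_lt_iff₀ (by positivity)] at hlt
    have hE' := hE k hk
    rw [le_div_iff₀ hp] at hE'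
    have h8 : 8 * A * E k < (μD * δ ^ 2 / 2) ^ 2 := by
      have h3 : 32 * A * (E k * (k : ℝ) ^ γ) ≤ 32 * A * C :=
        mul_le_mul_of_nonneg_left hE' (by positivity)
      have h4 : (k : ℝ) ^ γ * (32 * A * E k) < (k : ℝ) ^ γ * (μD * δ ^ 2) ^ 2 := by
        calc _ = 32 * A * (E k * (k : ℝ) ^ γ) := by ring
          _ < _ := lt_of_le_of_lt h3 hlt
      have h5 := lt_of_mul_lt_mul_left h4 hp.le
      have h6 : (μD * δ ^ 2 / 2) ^ 2 = (μD * δ ^ 2) ^ 2 / 4 := by ring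
      rw [h6]
      linarith
    have hg : G k < μD * δ ^ 2 / 2 :=
      lt_of_le_of_lt (hG k hk) ((Real.sqrt_lt' (by positivity)).2 h8)
    rw [Real.sqrt_lt' hδ, div_lt_iff₀ hμ]
    linarith
  refine ⟨h1, ?_⟩
  set T := 32 * A * C / (μD * δ ^ 2) ^ 2 with hT
  have hT0 : 0 < T := by positivity
  have hS0 : 0 ≤ T ^ (1 / γ) := by positivity
  have hmem : ⌊T ^ (1 / γ)⌋₊ + 1 ∈ {k : ℕ | 1 ≤ k ∧ Real.sqrt (2 * G k / μD) < δ} := by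
    refine ⟨by omega, h1 _ (by omega) ?_⟩
    have hlt : T ^ (1 / γ) < ((⌊T ^ (1 / γ)⌋₊ + 1 : ℕ) : ℝ) := by
      push_cast
      exact Nat.lt_floor_add_one _
    calc T = (T ^ (1 / γ)) ^ γ := by
          rw [← Real.rpow_mul hT0.le, one_div_mul_cancel hγ.ne', Real.rpow_one]
      _ < _ := Real.rpow_lt_rpow hS0 hlt hγ
  calc _ ≤ ((⌊T ^ (1 / γ)⌋₊ + 1 : ℕ) : ℝ) := by exact_mod_cast Nat.sInf_le hmem
    _ ≤ _ := by
      push_cast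
      have := Nat.floor_le hS0
      linarith
end
end
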